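/- arXiv:math/0610796 — 4 statements merged into one kernel-verified Lean document; each statement's English description precedes it below -/
import Mathlib

section
/- Let f : ℂ → ℂ be a nonconstant entire holomorphic function which never vanishes. Then there exist a sequence of positive real numbers (A_n), a sequence of complex numbers (B_n), and nonzero complex numbers C and d such that the sequence of functions z ↦ f(A_n·z + B_n) converges uniformly on every compact subset of ℂ to the function z ↦ C·exp(d·z). -/
open Filter Topology

/-- Hopf lemma combined with the Harnack gradient bound. -/
lemma hopf_pos (g : ℂ → ℂ) (hg : Differentiable ℂ g) (z p : ℂ) (r : ℝ) (hr : 0 < r)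
    (hpos : ∀ w ∈ Metric.ball z r, 0 < (g w).re) (hp : dist p z = r) (hp0 : (g p).re = 0) :
    ‖deriv g z‖ ≤ 4 * ‖deriv g p‖ := by
  have hu : 0 < (g z).re := hpos z (Metric.mem_ball_self hr)
  set φ : ℂ → ℂ := fun w => (g w - g z) / (g w + (starRingEnd ℂ) (g z)) with hφ
  have hden : ∀ w ∈ Metric.ball z r, g w + (starRingEnd ℂ) (g z) ≠ 0 := by
    intro w hw h
    have := congrArg Complex.re h
    simp at this
    linarith [hpos w hw]
  have hφz : φ z = 0 := by simp [hφ]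
  have hd : DifferentiableOn ℂ φ (Metric.ball z r) := by
    intro w hw
    apply DifferentiableAt.differentiableWithinAt
    exact ((hg w).sub_const _).div ((hg w).add_const _) (hden w hw)
  have hmaps : Set.MapsTo φ (Metric.ball z r) (Metric.closedBall (φ z) 1) := by
    intro w hw
    rw [hφz, mem_closedBall_zero_iff]
    simp only [hφ, norm_div]
    rw [div_le_one (norm_pos_iff.2 (hden w hw))]
    rw [Complex.norm_def, Complex.norm_def]
    apply Real.sqrt_le_sqrt
    simp [Complex.normSq_apply]
    nlinarith [hpos w hw]
  -- gradient bound
  have h1 : ‖deriv g z‖ ≤ 2 * (g z).re / r := by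
    have h := Complex.norm_deriv_le_div_of_mapsTo_ball hd hmaps hr
    have hder : HasDerivAt φ (deriv g z / (2 * (g z).re : ℝ)) z := by
      have h2 := ((hg z).hasDerivAt.sub_const (g z)).div
        ((hg z).hasDerivAt.add_const ((starRingEnd ℂ) (g z))) (hden z (Metric.mem_ball_self hr))
      refine HasDerivAt.congr_deriv h2 ?_
      rw [Complex.add_conj]
      have : ((2 * (g z).re : ℝ) : ℂ) ≠ 0 := by
        exact_mod_cast (by positivity : (2 * (g z).re) ≠ 0)
      field_simp
      simp
    rw [hder.deriv, norm_div, Complex.norm_real, Real.norm_of_nonneg (by positivity),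
      div_le_div_iff₀ (by positivity) hr] at h
    rw [le_div_iff₀ hr]
    linarith
  -- Hopf
  have hpz : ‖p - z‖ = r := by rw [← dist_eq_norm, hp]
  have h2 : (g z).re / 2 ≤ ‖deriv g p‖ * r := by
    set k : ℝ → ℝ := fun s => (g (z + (s : ℂ) * (p - z))).re + (s - 1) * ((g z).re / 2) with hk
    have hk1 : k 1 = 0 := by simp [hk, hp0]
    have hkpos : ∀ s ∈ Set.Ico (0 : ℝ) 1, 0 ≤ k s := by
      rintro s ⟨hs0, hs1⟩
      set w := z + (s : ℂ) * (p - z) with hw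
      have hdist : dist w z = s * r := by
        rw [dist_eq_norm, hw, add_sub_cancel_left, norm_mul, hpz, Complex.norm_real,
          Real.norm_of_nonneg hs0]
      have hwb : w ∈ Metric.ball z r := by
        rw [Metric.mem_ball, hdist]; nlinarith
      have h := Complex.dist_le_div_mul_dist_of_mapsTo_ball hd hmaps hwb
      rw [hφz, dist_zero_right, hdist] at h
      have hs : (1 / r * (s * r)) = s := by field_simp
      rw [hs] at h
      simp only [hφ, norm_div] at h
      rw [div_le_iff₀ (norm_pos_iff.2 (hden w hwb))] at h
      have hsq := pow_le_pow_left₀ (norm_nonneg _) h 2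
      rw [mul_pow, Complex.sq_norm, Complex.sq_norm] at hsq
      simp [Complex.normSq_apply] at hsq
      have ha := hpos w hwb
      have hsle : s ^ 2 ≤ 1 := by nlinarith
      have h3 : ((g z).re - (g w).re) ^ 2 ≤ (s * ((g w).re + (g z).re)) ^ 2 := by
        nlinarith [mul_nonneg (sub_nonneg.2 hsle) (sq_nonneg ((g w).im - (g z).im))]
      have h4 := abs_le_of_sq_le_sq' h3 (by positivity)
      show 0 ≤ (g w).re + (s - 1) * ((g z).re / 2)
      nlinarith [h4.2]
    have hkd : HasDerivAt k ((deriv g p * (p - z)).re + (g z).re / 2) 1 := by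
      have e1 : HasDerivAt (fun s : ℂ => z + s * (p - z)) (p - z) ((1 : ℝ) : ℂ) := by
        simpa using ((hasDerivAt_id ((1 : ℝ) : ℂ)).mul_const (p - z)).const_add z
      have e2 : HasDerivAt g (deriv g p) (z + ((1 : ℝ) : ℂ) * (p - z)) := by
        have : z + ((1 : ℝ) : ℂ) * (p - z) = p := by simp
        rw [this]; exact (hg p).hasDerivAt
      have e3 := (e2.comp ((1 : ℝ) : ℂ) e1).real_of_complex
      have e4 := ((hasDerivAt_id (1 : ℝ)).sub_const 1).mul_const ((g z).re / 2)
      simpa [hk] using! e3.add e4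
    have hle : (deriv g p * (p - z)).re + (g z).re / 2 ≤ 0 := by
      have ht := (hasDerivWithinAt_iff_tendsto_slope' (s := Set.Iio 1) (by simp)).1
        hkd.hasDerivWithinAt
      refine le_of_tendsto ht ?_
      filter_upwards [Ico_mem_nhdsLT (show (0 : ℝ) < 1 by norm_num)] with s hs
      rw [slope_def_field, hk1]
      exact div_nonpos_of_nonneg_of_nonpos (by linarith [hkpos s hs]) (by linarith [hs.2])
    have := Complex.abs_re_le_norm (deriv g p * (p - z))
    rw [norm_mul, hpz] at this
    linarith [neg_abs_le (deriv g p * (p - z)).re]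
  refine h1.trans ?_
  rw [div_le_iff₀ hr]
  linarith

lemma local_bound (g : ℂ → ℂ) (hg : Differentiable ℂ g) (B : ℂ) (hB : (g B).re = 0) (R M : ℝ)
    (hM : ∀ w, (g w).re = 0 → dist w B ≤ 2 * R → ‖deriv g w‖ ≤ M) (z : ℂ) (hz : dist z B ≤ R) :
    ‖deriv g z‖ ≤ 4 * M := by
  have hcont : Continuous fun w => (g w).re := Complex.continuous_re.comp hg.continuous
  have hclosed : IsClosed {w | (g w).re = 0} := isClosed_eq hcont continuous_const
  obtain ⟨p, hp, hpd⟩ := hclosed.exists_infDist_eq_dist ⟨B, hB⟩ z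
  have hle : ∀ w, (g w).re = 0 → dist z p ≤ dist z w := fun w hw => by
    rw [← hpd]; exact Metric.infDist_le_dist_of_mem hw
  have hpM : ‖deriv g p‖ ≤ M := by
    apply hM p hp
    have := hle B hB
    have := dist_triangle p z B
    rw [dist_comm p z] at this
    linarith
  have hp' : (g p).re = 0 := hp
  by_cases h0 : z = p
  · subst h0
    linarith [norm_nonneg (deriv g z)]
  have hr : 0 < dist z p := dist_pos.2 h0
  have hne : ∀ w ∈ Metric.ball z (dist z p), (g w).re ≠ 0 := by
    intro w hw h
    have := hle w h
    rw [Metric.mem_ball, dist_comm] at hw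
    linarith
  have hpre : IsPreconnected (Metric.ball z (dist z p)) := (convex_ball z _).isPreconnected
  have key : (∀ w ∈ Metric.ball z (dist z p), 0 < (g w).re) ∨
      (∀ w ∈ Metric.ball z (dist z p), (g w).re < 0) := by
    by_contra! hcon
    obtain ⟨⟨a, ha, ha'⟩, ⟨b, hb, hb'⟩⟩ := hcon
    obtain ⟨c, hc, hc'⟩ := hpre.intermediate_value ha hb hcont.continuousOn ⟨ha', hb'⟩
    exact hne c hc hc'
  rcases key with h | h
  · linarith [hopf_pos g hg z p _ hr h (dist_comm _ _) hp]
  · have := hopf_pos (fun w => -g w) hg.neg z p _ hr (fun w hw => by simpa using h w hw)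
      (dist_comm _ _) (by simpa using hp')
    simp only [deriv.fun_neg, norm_neg] at this
    linarith

lemma exists_log (f : ℂ → ℂ) (hf : Differentiable ℂ f) (hnv : ∀ z, f z ≠ 0) :
    ∃ g : ℂ → ℂ, Differentiable ℂ g ∧ ∀ z, f z = Complex.exp (g z) := by
  have hq : Differentiable ℂ (fun z => deriv f z / f z) := hf.deriv.div hf hnv
  obtain ⟨g, hg0, hg⟩ := hq.isExactOn_univ.with_val_at 0 (Complex.log (f 0))
  have hg' : ∀ z, HasDerivAt g (deriv f z / f z) z := fun z => hg z (Set.mem_univ z)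
  refine ⟨g, fun z => (hg' z).differentiableAt, fun z => ?_⟩
  have hd : ∀ z, HasDerivAt (fun z => f z * Complex.exp (-g z)) 0 z := fun z => by
    refine HasDerivAt.congr_deriv ((hf z).hasDerivAt.mul (hg' z).neg.cexp) ?_
    have := hnv z
    simp only [Pi.neg_apply]
    field_simp
    ring
  have := is_const_of_deriv_eq_zero (fun z => (hd z).differentiableAt) (fun z => (hd z).deriv) z 0
  simp only [hg0, Complex.exp_neg, Complex.exp_log (hnv 0)] at this
  rw [mul_inv_cancel₀ (hnv 0)] at this
  field_simp at this
  exact this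

lemma exists_re_zero (g : ℂ → ℂ) (hg : Differentiable ℂ g)
    (hnc : ¬ ∃ c : ℂ, ∀ z, Complex.exp (g z) = c) : ∃ z, (g z).re = 0 := by
  have hcont : Continuous fun w => (g w).re := Complex.continuous_re.comp hg.continuous
  by_contra! hne
  have key : (∀ w, 0 < (g w).re) ∨ (∀ w, (g w).re < 0) := by
    by_contra! hcon
    obtain ⟨⟨a, ha'⟩, ⟨b, hb'⟩⟩ := hcon
    obtain ⟨c, -, hc'⟩ := isPreconnected_univ.intermediate_value (Set.mem_univ a) (Set.mem_univ b)
      hcont.continuousOn ⟨ha', hb'⟩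
    exact hne c hc'
  apply hnc
  rcases key with h | h
  · obtain ⟨c, hc⟩ := (hg.neg.cexp).exists_const_forall_eq_of_bounded (by
      rw [isBounded_iff_forall_norm_le]
      refine ⟨1, ?_⟩
      rintro _ ⟨w, rfl⟩
      simp [Complex.norm_exp, (h w).le])
    refine ⟨c⁻¹, fun z => ?_⟩
    rw [← hc z]
    simp [Complex.exp_neg]
  · apply hg.cexp.exists_const_forall_eq_of_bounded
    rw [isBounded_iff_forall_norm_le]
    refine ⟨1, ?_⟩
    rintro _ ⟨w, rfl⟩
    simp [Complex.norm_exp, (h w).le]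

/-- One step of the renormalization. -/
lemma renorm_step (g : ℂ → ℂ) (hg : Differentiable ℂ g) (p : ℂ) (hp : (g p).re = 0) (N : ℝ)
    (hN : 0 < N) (hpN : N ≤ ‖deriv g p‖) :
    ∃ (A : ℝ) (B : ℂ), 0 < A ∧ (g B).re = 0 ∧ ‖deriv g B * A‖ = 1 ∧
      ∀ z : ℂ, ‖z‖ < N / 4 → ‖g (A * z + B) - g B - deriv g B * A * z‖ ≤ 64 * ‖z‖ ^ 2 / N := by
  have hcont : Continuous fun w => (g w).re := Complex.continuous_re.comp hg.continuous
  have hclosed : IsClosed {w | (g w).re = 0} := isClosed_eq hcont continuous_const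
  have hK : IsCompact (Metric.closedBall p 1 ∩ {w | (g w).re = 0}) :=
    (isCompact_closedBall p 1).inter_right hclosed
  have hdc : Continuous fun w => ‖deriv g w‖ * (1 - dist w p) :=
    hg.deriv.continuous.norm.mul (continuous_const.sub (continuous_id.dist continuous_const))
  obtain ⟨B, ⟨hB1, hB0⟩, hmax⟩ := hK.exists_isMaxOn ⟨p, by simp, hp⟩ hdc.continuousOn
  have hB0' : (g B).re = 0 := hB0
  have hm : ∀ w, dist w p ≤ 1 → (g w).re = 0 →
      ‖deriv g w‖ * (1 - dist w p) ≤ ‖deriv g B‖ * (1 - dist B p) := fun w h1 h2 => hmax ⟨h1, h2⟩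
  set L := ‖deriv g B‖ with hL
  set ρ := 1 - dist B p with hρ
  have hLρ : N ≤ L * ρ := by
    have := hm p (by simp) hp
    simp at this
    linarith
  have hρ0 : 0 ≤ ρ := by have := Metric.mem_closedBall.1 hB1; linarith
  have hL0 : 0 ≤ L := norm_nonneg _
  have hρpos : 0 < ρ := lt_of_le_of_ne hρ0 (by rintro h; rw [← h] at hLρ; linarith)
  have hLpos : 0 < L := lt_of_le_of_ne hL0 (by rintro h; rw [← h] at hLρ; linarith)
  have hZ : ∀ w, (g w).re = 0 → dist w B ≤ 2 * (ρ / 4) → ‖deriv g w‖ ≤ 2 * L := by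
    intro w hw hwB
    have ht := dist_triangle w B p
    have h1 := hm w (by linarith) hw
    have h2 : ρ / 2 ≤ 1 - dist w p := by linarith
    have h3 : ‖deriv g w‖ * (ρ / 2) ≤ L * ρ :=
      (mul_le_mul_of_nonneg_left h2 (norm_nonneg _)).trans h1
    by_contra! hcon
    nlinarith
  have hbd : ∀ w, dist w B ≤ ρ / 4 → ‖deriv g w‖ ≤ 8 * L := fun w hw => by
    linarith [local_bound g hg B hB0' (ρ / 4) (2 * L) hZ w hw]
  have hmaps : Set.MapsTo (deriv g) (Metric.ball B (ρ / 4))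
      (Metric.closedBall (deriv g B) (16 * L)) := by
    intro w hw
    rw [Metric.mem_closedBall, dist_eq_norm]
    have := norm_sub_le (deriv g w) (deriv g B)
    have := hbd w (Metric.mem_ball.1 hw).le
    linarith
  refine ⟨1 / L, B, by positivity, hB0', ?_, ?_⟩
  · rw [norm_mul, Complex.norm_real, Real.norm_of_nonneg (by positivity), ← hL]
    field_simp
  · intro z hz
    set t := ‖z‖ / L with ht
    have ht0 : 0 ≤ t := by positivity
    have htρ : t < ρ / 4 := by
      rw [ht, div_lt_iff₀ hLpos]; nlinarith
    set w := ((1 / L : ℝ) : ℂ) * z + B with hw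
    have hwB : ‖w - B‖ = t := by
      rw [hw, add_sub_cancel_right, norm_mul, Complex.norm_real,
        Real.norm_of_nonneg (by positivity), ht]
      ring
    have hmv := (convex_closedBall B t).norm_image_sub_le_of_norm_hasDerivWithin_le
      (f := fun y => g y - deriv g B * y) (f' := fun y => deriv g y - deriv g B)
      (C := 64 * L / ρ * t) (x := B) (y := w)
      (fun y hy => by
        simpa using! ((hg y).hasDerivAt.sub
          ((hasDerivAt_id y).const_mul (deriv g B))).hasDerivWithinAt)
      (fun y hy => by
        have hy' : dist y B ≤ t := hy
        have := Complex.dist_le_div_mul_dist_of_mapsTo_ball hg.deriv.differentiableOn hmaps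
          (Metric.mem_ball.2 (hy'.trans_lt htρ))
        rw [← dist_eq_norm]
        refine this.trans ?_
        have e : 16 * L / (ρ / 4) = 64 * L / ρ := by field_simp; norm_num
        rw [e]
        gcongr)
      (Metric.mem_closedBall_self ht0) (by rw [Metric.mem_closedBall, dist_eq_norm, hwB])
    rw [hwB] at hmv
    have e1 : g w - deriv g B * w - (g B - deriv g B * B) =
        g w - g B - deriv g B * ((1 / L : ℝ) : ℂ) * z := by
      rw [hw]; ring
    rw [e1] at hmv
    refine hmv.trans ?_
    have e2 : 64 * L / ρ * t * t = 64 * ‖z‖ ^ 2 / (L * ρ) := by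
      rw [ht]; field_simp
    rw [e2]
    gcongr

theorem stmt0 (f : ℂ → ℂ) (hf : Differentiable ℂ f)
    (hnc : ¬ ∃ c : ℂ, ∀ z, f z = c) (hnv : ∀ z, f z ≠ 0) :
    ∃ (A : ℕ → ℝ) (B : ℕ → ℂ) (C d : ℂ), (∀ n, 0 < A n) ∧ C ≠ 0 ∧ d ≠ 0 ∧
      ∀ K : Set ℂ, IsCompact K →
        TendstoUniformlyOn (fun n z => f ((A n : ℂ) * z + B n))
          (fun z => C * Complex.exp (d * z)) atTop K := by
  obtain ⟨g, hg, hfg⟩ := exists_log f hf hnv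
  obtain rfl : f = fun z => Complex.exp (g z) := funext hfg
  obtain ⟨p₀, hp₀⟩ := exists_re_zero g hg hnc
  by_cases hbd : ∃ M, ∀ w, (g w).re = 0 → ‖deriv g w‖ ≤ M
  · obtain ⟨M, hM⟩ := hbd
    have hb : ∀ z, ‖deriv g z‖ ≤ 4 * M := fun z =>
      local_bound g hg p₀ hp₀ (dist z p₀) M (fun w hw _ => hM w hw) z le_rfl
    obtain ⟨d, hd⟩ := hg.deriv.exists_const_forall_eq_of_bounded (by
      rw [isBounded_iff_forall_norm_le]
      refine ⟨4 * M, ?_⟩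
      rintro _ ⟨w, rfl⟩
      exact hb w)
    have hlin : ∀ z, g z = g 0 + d * z := by
      have hh : ∀ z, HasDerivAt (fun z => g z - d * z) 0 z := fun z => by
        simpa [hd z] using! (hg z).hasDerivAt.sub ((hasDerivAt_id z).const_mul d)
      intro z
      have := is_const_of_deriv_eq_zero (fun z => (hh z).differentiableAt)
        (fun z => (hh z).deriv) z 0
      simp only [mul_zero, sub_zero] at this
      rw [← this]; ring
    refine ⟨fun _ => 1, fun _ => 0, Complex.exp (g 0), d, fun _ => one_pos, Complex.exp_ne_zero _,
      ?_, ?_⟩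
    · rintro rfl
      exact hnc ⟨Complex.exp (g 0), fun z => by
        show Complex.exp (g z) = _
        rw [hlin z]; simp⟩
    · intro K _ u hu
      refine Eventually.of_forall fun n z _ => ?_
      have : Complex.exp (g (((1 : ℝ) : ℂ) * z + 0)) = Complex.exp (g 0) * Complex.exp (d * z) := by
        rw [hlin, ← Complex.exp_add]; simp
      simp only [this]
      exact refl_mem_uniformity hu
  · push Not at hbd
    have hstep : ∀ n : ℕ, ∃ (A : ℝ) (B : ℂ), 0 < A ∧ (g B).re = 0 ∧ ‖deriv g B * A‖ = 1 ∧
        ∀ z : ℂ, ‖z‖ < ((n : ℝ) + 1) / 4 →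
          ‖g (A * z + B) - g B - deriv g B * A * z‖ ≤ 64 * ‖z‖ ^ 2 / ((n : ℝ) + 1) := fun n => by
      obtain ⟨p, hp, hpn⟩ := hbd ((n : ℝ) + 1)
      exact renorm_step g hg p hp _ (by positivity) hpn.le
    choose A B hA hB hAB hest using hstep
    have hcpt : IsCompact (Metric.sphere (0 : ℂ) 1 ×ˢ Metric.sphere (0 : ℂ) 1) :=
      (isCompact_sphere 0 1).prod (isCompact_sphere 0 1)
    obtain ⟨⟨C, d⟩, ⟨hC, hd⟩, φ, hφ, hlim⟩ := hcpt.tendsto_subseq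
      (x := fun n => (Complex.exp (g (B n)), deriv g (B n) * A n))
      (fun n => ⟨by simp [Complex.norm_exp, hB], by simpa using hAB n⟩)
    have hC1 : ‖C‖ = 1 := by simpa using hC
    have hd1 : ‖d‖ = 1 := by simpa using hd
    refine ⟨A ∘ φ, B ∘ φ, C, d, fun n => hA _, fun h => by simp [h] at hC1,
      fun h => by simp [h] at hd1, ?_⟩
    rw [← tendstoLocallyUniformly_iff_forall_isCompact, tendstoLocallyUniformly_iff_forall_tendsto]
    intro x
    have hCl : Tendsto (fun n => Complex.exp (g (B (φ n)))) atTop (𝓝 C) :=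
      (continuous_fst.tendsto _).comp hlim
    have hdl : Tendsto (fun n => deriv g (B (φ n)) * A (φ n)) atTop (𝓝 d) :=
      (continuous_snd.tendsto _).comp hlim
    have hn : Tendsto (fun y : ℕ × ℂ => ((φ y.1 : ℕ) : ℝ) + 1) (atTop ×ˢ 𝓝 x) atTop :=
      tendsto_atTop_add_const_right _ _
        ((tendsto_natCast_atTop_atTop.comp hφ.tendsto_atTop).comp tendsto_fst)
    have hy : Tendsto (fun y : ℕ × ℂ => y.2) (atTop ×ˢ 𝓝 x) (𝓝 x) := tendsto_snd
    have heps : Tendsto (fun y : ℕ × ℂ => g (A (φ y.1) * y.2 + B (φ y.1)) - g (B (φ y.1))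
        - deriv g (B (φ y.1)) * A (φ y.1) * y.2) (atTop ×ˢ 𝓝 x) (𝓝 0) := by
      have hmaj : Tendsto (fun y : ℕ × ℂ => 64 * ‖y.2‖ ^ 2 / (((φ y.1 : ℕ) : ℝ) + 1))
          (atTop ×ˢ 𝓝 x) (𝓝 0) := ((hy.norm.pow 2).const_mul 64).div_atTop hn
      refine squeeze_zero_norm' ?_ hmaj
      have e1 : ∀ᶠ y : ℕ × ℂ in atTop ×ˢ 𝓝 x, ‖y.2‖ < ‖x‖ + 1 :=
        hy.norm.eventually (gt_mem_nhds (by linarith))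
      filter_upwards [e1, hn.eventually_ge_atTop (4 * (‖x‖ + 1))] with y h1 h2
      exact hest _ _ (by linarith)
    have hF : Tendsto (fun y : ℕ × ℂ => Complex.exp (g (A (φ y.1) * y.2 + B (φ y.1))))
        (atTop ×ˢ 𝓝 x) (𝓝 (C * Complex.exp (d * x))) := by
      have h3 := (hCl.comp tendsto_fst).mul
        (((hdl.comp tendsto_fst).mul hy).add heps).cexp
      rw [add_zero] at h3
      refine h3.congr fun y => ?_
      simp only [Function.comp]
      rw [← Complex.exp_add]
      congr 1
      ring
    have hG : Tendsto (fun y : ℕ × ℂ => C * Complex.exp (d * y.2))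
        (atTop ×ˢ 𝓝 x) (𝓝 (C * Complex.exp (d * x))) :=
      (hy.const_mul d).cexp.const_mul C
    exact (hG.prodMk_nhds hF).mono_right (nhds_le_uniformity _)
end

section
/- Let (V,d) be a complete metric space and φ : V → [0,∞) a locally bounded function. Fix τ > 1, ε > 0 and p ∈ V with φ(p) > 0. Then there exists q ∈ V such that: (1) d(p,q) ≤ τ/(ε·φ(p)·(τ−1)); (2) φ(q) ≥ φ(p); (3) for every x ∈ V with d(x,q) ≤ 1/(ε·φ(q)) one has φ(x) ≤ τ·φ(q). -/
open Filter Topology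

/-- **General renormalization lemma.** Let `(V,d)` be a complete metric space and
`φ : V → [0,∞)` locally bounded. Fix `τ > 1`, `ε > 0` and `p` with `φ p > 0`. Then there is
`q ∈ V` with `d(p,q) ≤ τ/(ε φ(p) (τ-1))`, `φ(q) ≥ φ(p)`, and `φ(x) ≤ τ φ(q)` whenever
`d(x,q) ≤ 1/(ε φ(q))`. -/
theorem stmt1 {V : Type*} [MetricSpace V] [CompleteSpace V]
    (φ : V → ℝ) (hφ0 : ∀ x, 0 ≤ φ x)
    (hloc : ∀ x : V, ∃ s ∈ 𝓝 x, ∃ M : ℝ, ∀ y ∈ s, φ y ≤ M)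
    (τ ε : ℝ) (hτ : 1 < τ) (hε : 0 < ε) (p : V) (hp : 0 < φ p) :
    ∃ q : V, dist p q ≤ τ / (ε * φ p * (τ - 1)) ∧ φ p ≤ φ q ∧
      ∀ x : V, dist x q ≤ 1 / (ε * φ q) → φ x ≤ τ * φ q := by
  by_contra! hcon
  have hτ0 : 0 < τ := by linarith
  have hτ1 : 0 < τ - 1 := by linarith
  have hex : ∀ q : V, ∃ x : V, (dist p q ≤ τ / (ε * φ p * (τ - 1)) → φ p ≤ φ q →
      dist x q ≤ 1 / (ε * φ q) ∧ τ * φ q < φ x) := by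
    intro q
    by_cases h : dist p q ≤ τ / (ε * φ p * (τ - 1)) ∧ φ p ≤ φ q
    · obtain ⟨x, hx⟩ := hcon q h.1 h.2
      exact ⟨x, fun _ _ => hx⟩
    · exact ⟨q, fun h1 h2 => absurd ⟨h1, h2⟩ h⟩
  choose f hf using hex
  set C := τ / (ε * φ p * (τ - 1)) with hC
  have hC0 : 0 < C := by positivity
  let u : ℕ → V := fun n => f^[n] p
  have hu : ∀ n, u (n + 1) = f (u n) := fun n => Function.iterate_succ_apply' f n p
  have hsmall : ∀ n, τ ^ n * φ p ≤ φ (u n) →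
      1 / (ε * φ (u n)) ≤ C * (1 / τ ^ n - 1 / τ ^ (n + 1)) := by
    intro n hn
    have h1 : C * (1 / τ ^ n - 1 / τ ^ (n + 1)) = 1 / (ε * (τ ^ n * φ p)) := by
      rw [hC, pow_succ]
      field_simp
    rw [h1]
    gcongr
  have key : ∀ n, dist p (u n) ≤ C * (1 - 1 / τ ^ n) ∧ τ ^ n * φ p ≤ φ (u n) := by
    intro n
    have aux : ∀ n, dist p (u n) ≤ C * (1 - 1 / τ ^ n) → τ ^ n * φ p ≤ φ (u n) →
        dist p (u n) ≤ C ∧ φ p ≤ φ (u n) := by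
      intro n h1 h2
      have : 0 < C * (1 / τ ^ n) := by positivity
      have h3 : 1 ≤ τ ^ n := one_le_pow₀ hτ.le
      constructor <;> nlinarith
    induction n with
    | zero => simp [u]
    | succ n ih =>
      obtain ⟨a, b⟩ := aux n ih.1 ih.2
      obtain ⟨h1, h2⟩ := hf (u n) a b
      rw [← hu] at h1 h2
      have h3 := hsmall n ih.2
      have h4 := dist_triangle p (u n) (u (n + 1))
      rw [dist_comm] at h1
      refine ⟨by nlinarith [ih.1], ?_⟩
      rw [pow_succ]
      nlinarith [ih.2]
  have hstep : ∀ n, dist (u n) (u (n + 1)) ≤ C * (1 / τ) ^ n := by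
    intro n
    obtain ⟨h1, h2⟩ := key n
    have h0 : 0 < C * (1 / τ ^ n) := by positivity
    have h0' : 0 < C * (1 / τ ^ (n + 1)) := by positivity
    have h3 : 1 ≤ τ ^ n := one_le_pow₀ hτ.le
    have h5 := (hf (u n) (by nlinarith) (by nlinarith)).1
    rw [← hu, dist_comm] at h5
    have h6 := hsmall n h2
    rw [one_div_pow]
    nlinarith
  have hr : 1 / τ < 1 := by rw [div_lt_one hτ0]; exact hτ
  obtain ⟨q, hq⟩ := cauchySeq_tendsto_of_complete (cauchySeq_of_le_geometric _ C hr hstep)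
  obtain ⟨s, hs, M, hM⟩ := hloc q
  have hT : Tendsto (fun n : ℕ => τ ^ n * φ p) atTop atTop :=
    (tendsto_pow_atTop_atTop_of_one_lt hτ).atTop_mul_const hp
  obtain ⟨n, hn1, hn2⟩ := ((hq.eventually hs).and (hT.eventually_gt_atTop M)).exists
  have := hM _ hn1
  have := (key n).2
  linarith
end

section
/- Let U be a domain in ℝ^m and (g_n) a sequence of harmonic functions on U converging, uniformly on every compact subset of U with respect to the distance d on [−∞,+∞], to a function g : U → [−∞,+∞]. If g takes the value +∞ (respectively −∞) at some point of U, then g is identically equal to +∞ (respectively −∞) on U; moreover, in that case g̃_n converges to 0 uniformly on every compact subset of U. -/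
open Filter Topology Metric

noncomputable section

/-- `ℝ^m` with the Euclidean structure. -/
abbrev E (m : ℕ) := EuclideanSpace ℝ (Fin m)

/-- The Laplacian of `f` at `x`. -/
noncomputable def lap {m : ℕ} (f : E m → ℝ) (x : E m) : ℝ :=
  ∑ i, fderiv ℝ (fun y => fderiv ℝ f y (EuclideanSpace.single i 1)) x (EuclideanSpace.single i 1)

/-- `f` is harmonic on `U`: real-valued, `C²` with vanishing Laplacian. -/
def HarmOn {m : ℕ} (U : Set (E m)) (f : E m → ℝ) : Prop :=
  ContDiffOn ℝ 2 f U ∧ ∀ x ∈ U, lap f x = 0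

/-- `f̃ x = |∇f(x)| / cosh (f x)`. -/
noncomputable def tilde {m : ℕ} (f : E m → ℝ) (x : E m) : ℝ :=
  ‖gradient f x‖ / Real.cosh (f x)

/-- `S(x) = arctan (sinh x)`, extended to `[-∞,+∞]` by `S(±∞) = ±π/2`.  The distance on
`[-∞,+∞]` is `d(x,y) = |S x - S y|`. -/
noncomputable def SF : EReal → ℝ := fun x =>
  if x = ⊤ then Real.pi / 2 else if x = ⊥ then -(Real.pi / 2)
  else Real.arctan (Real.sinh x.toReal)

/-- Uniform convergence on every compact subset of `U`, with respect to the distance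
`d(x,y) = |S x - S y|` on `[-∞,+∞]`. -/
def TendstoCptsE {m : ℕ} (U : Set (E m)) (g : ℕ → E m → EReal) (G : E m → EReal) : Prop :=
  ∀ K ⊆ U, IsCompact K → ∀ ε > 0, ∃ N : ℕ, ∀ n ≥ N, ∀ x ∈ K, |SF (g n x) - SF (G x)| < ε

/-- A family `Fam` of harmonic functions on `U` is normal if every sequence in `Fam` has a
subsequence converging uniformly on compact subsets of `U` either to a harmonic function on
`U`, or to the constant `+∞`, or to the constant `-∞`. -/
def NormalFam {m : ℕ} (U : Set (E m)) (Fam : Set (E m → ℝ)) : Prop :=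
  ∀ f : ℕ → E m → ℝ, (∀ n, f n ∈ Fam) →
    ∃ φ : ℕ → ℕ, StrictMono φ ∧
      ((∃ g : E m → ℝ, HarmOn U g ∧
          TendstoCptsE U (fun k x => ((f (φ k) x : ℝ) : EReal)) (fun x => ((g x : ℝ) : EReal)))
       ∨ TendstoCptsE U (fun k x => ((f (φ k) x : ℝ) : EReal)) (fun _ => (⊤ : EReal))
       ∨ TendstoCptsE U (fun k x => ((f (φ k) x : ℝ) : EReal)) (fun _ => (⊥ : EReal)))

open MeasureTheory

lemma hasDerivAt_max_sq (s : ℝ) : HasDerivAt (fun s : ℝ => (max 0 s) ^ 2) (2 * max 0 s) s := by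
  rcases lt_trichotomy s 0 with h | h | h
  · rw [max_eq_left h.le]
    have : (fun s : ℝ => (max 0 s) ^ 2) =ᶠ[𝓝 s] fun _ => 0 := by
      filter_upwards [Iio_mem_nhds h] with x hx
      simp [max_eq_left (le_of_lt (Set.mem_Iio.1 hx))]
    simpa using (hasDerivAt_const s (0:ℝ)).congr_of_eventuallyEq this
  · subst h
    rw [hasDerivAt_iff_isLittleO_nhds_zero]
    have h1 : (fun h : ℝ => h ^ 2) =o[𝓝 0] fun h => h := by
      simpa using (Asymptotics.isLittleO_pow_id (𝕜 := ℝ) (n := 2) (by norm_num))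
    refine Asymptotics.IsBigO.trans_isLittleO ?_ h1
    refine Asymptotics.IsBigO.of_bound 1 (Eventually.of_forall fun x => ?_)
    simp only [zero_add, max_self, mul_zero, smul_zero, sub_zero, one_mul, norm_pow,
      Real.norm_eq_abs]
    simp only [ne_eq, OfNat.ofNat_ne_zero, not_false_eq_true, zero_pow, sub_zero, abs_pow]
    refine pow_le_pow_left₀ (abs_nonneg _) ?_ 2
    rcases le_total 0 x with hx | hx
    · simp [hx]
    · rw [max_eq_left hx, abs_zero]; exact abs_nonneg x
  · rw [max_eq_right h.le]
    have : (fun s : ℝ => (max 0 s) ^ 2) =ᶠ[𝓝 s] fun s => s ^ 2 := by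
      filter_upwards [Ioi_mem_nhds h] with x hx
      simp [max_eq_right (le_of_lt (Set.mem_Ioi.1 hx))]
    simpa using (hasDerivAt_pow 2 s).congr_of_eventuallyEq this

def eta {m : ℕ} (y : E m) : ℝ := max 0 (1 - ‖y‖ ^ 2)

lemma eta_nonneg {m : ℕ} (y : E m) : 0 ≤ eta y := le_max_left _ _

lemma eta_continuous {m : ℕ} : Continuous (eta (m := m)) := by
  unfold eta; fun_prop

lemma eta_eq_zero {m : ℕ} {y : E m} (h : 1 ≤ ‖y‖) : eta y = 0 := by
  unfold eta; apply max_eq_left; nlinarith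

lemma eta_eq {m : ℕ} (y : E m) : eta y = 1 - (min 1 ‖y‖) ^ 2 := by
  rcases le_total 1 ‖y‖ with h | h
  · rw [eta_eq_zero h, min_eq_left h]; norm_num
  · rw [min_eq_right h]; unfold eta; apply max_eq_right; nlinarith [norm_nonneg y]

lemma eta_lip {m : ℕ} (y z : E m) : |eta y - eta z| ≤ 2 * ‖y - z‖ := by
  rw [eta_eq, eta_eq]
  have h1 : |min 1 ‖y‖ - min 1 ‖z‖| ≤ ‖y - z‖ := by
    have := abs_min_sub_min_le_max 1 ‖y‖ 1 ‖z‖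
    have h2 := abs_norm_sub_norm_le y z
    refine this.trans ?_
    simp [h2]
  have h3 : 0 ≤ min 1 ‖y‖ := by positivity
  have h4 : 0 ≤ min 1 ‖z‖ := by positivity
  have : 1 - min 1 ‖y‖ ^ 2 - (1 - min 1 ‖z‖ ^ 2)
      = -((min 1 ‖y‖ - min 1 ‖z‖) * (min 1 ‖y‖ + min 1 ‖z‖)) := by ring
  rw [this, abs_neg, abs_mul, abs_of_nonneg (add_nonneg h3 h4)]
  have h5 := min_le_left 1 ‖y‖
  have h6 := min_le_left 1 ‖z‖
  nlinarith [abs_nonneg (min 1 ‖y‖ - min 1 ‖z‖)]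

lemma eta_compact {m : ℕ} : HasCompactSupport (eta (m := m)) := by
  refine HasCompactSupport.intro (isCompact_closedBall (0 : E m) 1) fun x hx => ?_
  apply eta_eq_zero
  simp at hx; exact hx.le

lemma eta_int_pos {m : ℕ} : 0 < ∫ y : E m, eta y :=
  eta_continuous.integral_pos_of_hasCompactSupport_nonneg_nonzero eta_compact
    (fun y => eta_nonneg y) (x := 0) (by simp [eta])

lemma psi_deriv {m : ℕ} (y : E m) :
    HasFDerivAt (fun y : E m => eta y ^ 2) ((-4 * eta y) • innerSL ℝ y) y := by
  have h1 : HasFDerivAt (fun y : E m => 1 - ‖y‖ ^ 2) (-(2 • innerSL ℝ y)) y := by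
    have := (hasStrictFDerivAt_norm_sq y).hasFDerivAt
    exact this.const_sub 1
  have := (hasDerivAt_max_sq (1 - ‖y‖ ^ 2)).comp_hasFDerivAt y h1
  refine HasFDerivAt.congr_fderiv (f := fun y : E m => eta y ^ 2) this ?_
  have h4 : (-4 * eta y) = (2 * max 0 (1 - ‖y‖ ^ 2)) * (-2) := by unfold eta; ring
  refine ContinuousLinearMap.ext fun z => ?_
  rw [h4]
  simp
  ring

lemma lin_sum {m : ℕ} (L : E m →L[ℝ] ℝ) (y : E m) :
    L y = ∑ i, y i * L (EuclideanSpace.single i 1) := by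
  conv_lhs => rw [← (EuclideanSpace.basisFun (Fin m) ℝ).sum_repr y]
  simp

lemma F_deriv {m : ℕ} (v : E m → ℝ) (hv : ContDiff ℝ 2 v) (hc : HasCompactSupport v) (x : E m)
    (t : ℝ) : HasDerivAt (fun t : ℝ => ∫ y, v (x + t • y) * eta y)
      (∫ y, fderiv ℝ v (x + t • y) y * eta y) t := by
  have hd : Continuous (fderiv ℝ v) := hv.continuous_fderiv (by norm_num)
  obtain ⟨C, hC⟩ := (hc.fderiv (𝕜 := ℝ)).exists_bound_of_continuous hd
  refine (hasDerivAt_integral_of_dominated_loc_of_deriv_le (s := Set.univ)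
    (bound := fun y => C * eta y) (F := fun t y => v (x + t • y) * eta y)
    (F' := fun t y => fderiv ℝ v (x + t • y) y * eta y) univ_mem ?_ ?_ ?_ ?_ ?_ ?_).2
  · refine Eventually.of_forall fun s => Continuous.aestronglyMeasurable ?_
    have := hv.continuous
    have := eta_continuous (m := m)
    fun_prop
  · refine Continuous.integrable_of_hasCompactSupport ?_ eta_compact.mul_left
    have := hv.continuous
    have := eta_continuous (m := m)
    fun_prop
  · refine Continuous.aestronglyMeasurable ?_
    have := eta_continuous (m := m)
    exact ((hd.comp (by fun_prop : Continuous fun y : E m => x + t • y)).clm_apply continuous_id).mul this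
  · refine Eventually.of_forall fun y s _ => ?_
    rw [norm_mul, Real.norm_of_nonneg (eta_nonneg y)]
    rcases le_total 1 ‖y‖ with h | h
    · simp [eta_eq_zero h]
    · refine mul_le_mul_of_nonneg_right ?_ (eta_nonneg y)
      refine ((fderiv ℝ v (x + s • y)).le_opNorm y).trans ?_
      have := hC (x + s • y)
      nlinarith [norm_nonneg y, norm_nonneg (fderiv ℝ v (x + s • y))]
  · exact (eta_continuous.integrable_of_hasCompactSupport eta_compact).const_mul C
  · refine Eventually.of_forall fun y s _ => HasDerivAt.mul_const ?_ (eta y)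
    have h1 : HasDerivAt (fun s : ℝ => x + s • y) y s := by
      simpa using ((hasDerivAt_id s).smul_const y).const_add x
    exact ((hv.differentiable (by norm_num)) (x + s • y)).hasFDerivAt.comp_hasDerivAt s h1

lemma F_deriv_zero {m : ℕ} (v : E m → ℝ) (hv : ContDiff ℝ 2 v)
    (x : E m) (R : ℝ) (hl : ∀ z ∈ ball x R, lap v z = 0)
    (t : ℝ) (ht : 0 ≤ t) (htR : t < R) :
    ∫ y, fderiv ℝ v (x + t • y) y * eta y = 0 := by
  have he := eta_continuous (m := m)
  have hpsi : ∀ i : Fin m, ∀ y : E m,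
      fderiv ℝ (fun y : E m => eta y ^ 2) y (EuclideanSpace.single i 1) = -4 * eta y * y i := by
    intro i y
    rw [(psi_deriv y).fderiv]
    simp [innerSL_apply_apply, EuclideanSpace.inner_single_right]
  have hD : ContDiff ℝ 1 (fderiv ℝ v) := hv.fderiv_right (by norm_num)
  have hDi : ∀ i : Fin m, ContDiff ℝ 1 (fun z => fderiv ℝ v z (EuclideanSpace.single i 1)) :=
    fun i => hD.clm_apply contDiff_const
  have hfi : ∀ i : Fin m, ContDiff ℝ 1
      (fun y => fderiv ℝ v (x + t • y) (EuclideanSpace.single i 1)) :=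
    fun i => (hDi i).comp (by fun_prop)
  have hfd : ∀ i : Fin m, ∀ y : E m,
      fderiv ℝ (fun y => fderiv ℝ v (x + t • y) (EuclideanSpace.single i 1)) y
        (EuclideanSpace.single i 1)
      = t * fderiv ℝ (fun z => fderiv ℝ v z (EuclideanSpace.single i 1)) (x + t • y)
        (EuclideanSpace.single i 1) := by
    intro i y
    have h1 : HasFDerivAt (fun y : E m => x + t • y) (t • ContinuousLinearMap.id ℝ (E m)) y :=
      ((hasFDerivAt_id y).const_smul t).const_add x
    have h2 := (((hDi i).differentiable (by norm_num)) (x + t • y)).hasFDerivAt.comp y h1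
    have h3 := h2.fderiv
    simp only [Function.comp_def] at h3
    rw [h3]
    simp
  have hint1 : ∀ i : Fin m, Integrable fun y : E m =>
      fderiv ℝ (fun y => fderiv ℝ v (x + t • y) (EuclideanSpace.single i 1)) y
        (EuclideanSpace.single i 1) * eta y ^ 2 := by
    intro i
    refine Continuous.integrable_of_hasCompactSupport ?_ ?_
    · exact (((hfi i).continuous_fderiv (by norm_num)).clm_apply continuous_const).mul (he.pow 2)
    · refine HasCompactSupport.mul_left ?_
      simp only [pow_two]; exact (eta_compact (m := m)).mul_left (f := eta)
  have hint2 : ∀ i : Fin m, Integrable fun y : E m =>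
      fderiv ℝ v (x + t • y) (EuclideanSpace.single i 1) * (-4 * eta y * y i) := by
    intro i
    refine Continuous.integrable_of_hasCompactSupport ?_ ?_
    · have := (hfi i).continuous
      fun_prop
    · refine HasCompactSupport.mul_left ?_
      exact HasCompactSupport.mul_right (eta_compact.mul_left)
  have hparts : ∀ i : Fin m,
      ∫ y, fderiv ℝ v (x + t • y) (EuclideanSpace.single i 1) * (-4 * eta y * y i)
      = - ∫ y, fderiv ℝ (fun y => fderiv ℝ v (x + t • y) (EuclideanSpace.single i 1)) y
        (EuclideanSpace.single i 1) * eta y ^ 2 := by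
    intro i
    simp only [← hpsi i]
    refine integral_mul_fderiv_eq_neg_fderiv_mul_of_integrable (hint1 i) ?_ ?_ ?_ ?_
    · simp only [hpsi]; exact hint2 i
    · refine Continuous.integrable_of_hasCompactSupport ?_ ?_
      · exact (hfi i).continuous.mul (he.pow 2)
      · refine HasCompactSupport.mul_left ?_
        simp only [pow_two]; exact (eta_compact (m := m)).mul_left (f := eta)
    · exact fun y _ => (hfi i).differentiable (by norm_num) y
    · exact fun y _ => (psi_deriv y).differentiableAt
  have hsum : -4 * ∫ y, fderiv ℝ v (x + t • y) y * eta y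
      = ∑ i, ∫ y, fderiv ℝ v (x + t • y) (EuclideanSpace.single i 1) * (-4 * eta y * y i) := by
    rw [← integral_finsetSum _ (fun i _ => hint2 i), ← integral_const_mul]
    congr 1
    ext y
    rw [lin_sum (fderiv ℝ v (x + t • y)) y, Finset.sum_mul, Finset.mul_sum]
    exact Finset.sum_congr rfl fun i _ => by ring
  have hz : ∑ i, ∫ y, fderiv ℝ v (x + t • y) (EuclideanSpace.single i 1) * (-4 * eta y * y i) = 0 := by
    simp only [hparts]
    rw [Finset.sum_neg_distrib, ← integral_finsetSum _ (fun i _ => hint1 i), neg_eq_zero]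
    rw [← integral_zero (E m) ℝ]
    congr 1
    ext y
    rcases le_or_gt 1 ‖y‖ with h | h
    · simp [eta_eq_zero h]
    · have := hl (x + t • y) (by
        simp [norm_smul, abs_of_nonneg ht]; nlinarith [norm_nonneg y])
      simp only [hfd]
      rw [← Finset.sum_mul, ← Finset.mul_sum]
      unfold lap at this
      rw [this]; simp
  rw [hz] at hsum
  linarith

lemma mean_value {m : ℕ} (v : E m → ℝ) (hv : ContDiff ℝ 2 v) (hc : HasCompactSupport v)
    (x : E m) (R : ℝ) (hR : 0 < R) (hl : ∀ z ∈ ball x R, lap v z = 0) :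
    ∫ y, v (x + R • y) * eta y = v x * ∫ y : E m, eta y := by
  have h := constant_of_derivWithin_zero (f := fun t : ℝ => ∫ y, v (x + t • y) * eta y)
    (a := 0) (b := R)
    (fun t _ => (F_deriv v hv hc x t).differentiableAt.differentiableWithinAt) (by
      intro t ht
      rw [(F_deriv v hv hc x t).hasDerivWithinAt.derivWithin
        (uniqueDiffOn_Icc hR t ⟨ht.1, ht.2.le⟩)]
      exact F_deriv_zero v hv x R hl t ht.1 ht.2) R ⟨hR.le, le_rfl⟩
  simp only [zero_smul, add_zero, integral_const_mul] at h
  exact h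

lemma mean_value' {m : ℕ} (v : E m → ℝ) (hv : ContDiff ℝ 2 v) (hc : HasCompactSupport v)
    (x : E m) (R : ℝ) (hR : 0 < R) (hl : ∀ z ∈ ball x R, lap v z = 0) :
    ∫ z, v z * eta (R⁻¹ • (z - x)) = R ^ m * (v x * ∫ y : E m, eta y) := by
  rw [← mean_value v hv hc x R hR hl]
  have h1 := Measure.integral_comp_smul (volume : Measure (E m))
    (fun w => v (x + w) * eta (R⁻¹ • w)) R
  have h2 := integral_sub_right_eq_self (μ := (volume : Measure (E m)))
    (fun w => v (x + w) * eta (R⁻¹ • w)) x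
  simp only [add_sub_cancel] at h2
  rw [h2]
  simp only [smul_smul, inv_mul_cancel₀ hR.ne', one_smul] at h1
  rw [h1, finrank_euclideanSpace_fin, abs_of_pos (by positivity), smul_eq_mul,
    mul_inv_cancel_left₀ (by positivity)]

lemma lap_congr {m : ℕ} {f h : E m → ℝ} {x : E m} (hfh : f =ᶠ[𝓝 x] h) : lap f x = lap h x := by
  unfold lap
  refine Finset.sum_congr rfl fun i _ => ?_
  have : (fun y => fderiv ℝ f y (EuclideanSpace.single i 1)) =ᶠ[𝓝 x]
      (fun y => fderiv ℝ h y (EuclideanSpace.single i 1)) := by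
    filter_upwards [hfh.fderiv (𝕜 := ℝ)] with y hy
    rw [hy]
  rw [this.fderiv_eq]

lemma exists_cutoff {m : ℕ} {U : Set (E m)} (hU : IsOpen U) {u : E m → ℝ} (hu : HarmOn U u)
    {x0 : E m} {r : ℝ} (hr : 0 < r) (hb : closedBall x0 (4 * r) ⊆ U)
    (hpos : ∀ z ∈ closedBall x0 (4 * r), 0 ≤ u z) :
    ∃ v : E m → ℝ, ContDiff ℝ 2 v ∧ HasCompactSupport v ∧ (∀ z, 0 ≤ v z) ∧
      (∀ z ∈ closedBall x0 (3 * r), v z = u z) ∧ ∀ z ∈ ball x0 (3 * r), lap v z = 0 := by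
  let χ : ContDiffBump x0 := ⟨3 * r, 4 * r, by positivity, by linarith⟩
  have hχ : tsupport χ = closedBall x0 (4 * r) := χ.tsupport_eq
  have heq : ∀ z ∈ closedBall x0 (3 * r), χ z * u z = u z := by
    intro z hz
    rw [χ.one_of_mem_closedBall hz, one_mul]
  refine ⟨fun z => χ z * u z, ?_, χ.hasCompactSupport.mul_right, ?_, heq, ?_⟩
  · rw [contDiff_iff_contDiffAt]
    intro z
    by_cases hz : z ∈ closedBall x0 (4 * r)
    · exact χ.contDiff.contDiffAt.mul (hu.1.contDiffAt (hU.mem_nhds (hb hz)))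
    · have : (fun z => χ z * u z) =ᶠ[𝓝 z] fun _ => 0 := by
        rw [← hχ] at hz
        filter_upwards [(isClosed_tsupport χ).isOpen_compl.mem_nhds hz] with w hw
        rw [image_eq_zero_of_notMem_tsupport hw, zero_mul]
      exact contDiffAt_const.congr_of_eventuallyEq this
  · intro z
    by_cases hz : z ∈ closedBall x0 (4 * r)
    · exact mul_nonneg χ.nonneg (hpos z hz)
    · rw [← hχ] at hz
      simp only [image_eq_zero_of_notMem_tsupport hz, zero_mul, le_refl]
  · intro z hz
    rw [lap_congr (h := u)]
    · exact hu.2 z (hb ((ball_subset_closedBall.trans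
        (closedBall_subset_closedBall (by linarith))) hz))
    · filter_upwards [isOpen_ball.mem_nhds hz] with w hw
      exact heq w (ball_subset_closedBall hw)

lemma harm_lip {m : ℕ} {U : Set (E m)} (hU : IsOpen U) {u : E m → ℝ} (hu : HarmOn U u)
    {x0 : E m} {r : ℝ} (hr : 0 < r) (hb : closedBall x0 (4 * r) ⊆ U)
    (hpos : ∀ z ∈ closedBall x0 (4 * r), 0 ≤ u z) {x : E m} (hx : ‖x - x0‖ ≤ r) :
    |u x - u x0| ≤ (4 * 3 ^ m / r * u x0) * ‖x - x0‖ := by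
  obtain ⟨v, hv, hc, hv0, hvu, hl⟩ := exists_cutoff hU hu hr hb hpos
  rw [← hvu x0 (mem_closedBall_self (by positivity)),
    ← hvu x (by rw [mem_closedBall, dist_eq_norm]; linarith)]
  have hmx := mean_value' v hv hc x r hr (fun z hz => hl z (by
    rw [mem_ball, dist_eq_norm] at *
    have : z - x0 = (z - x) + (x - x0) := by abel
    rw [this]
    linarith [norm_add_le (z - x) (x - x0)]))
  have hm0 := mean_value' v hv hc x0 r hr (fun z hz => hl z (ball_subset_ball (by linarith) hz))
  have hm3 := mean_value' v hv hc x0 (3 * r) (by positivity) hl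
  have hint : ∀ (a : E m) (s : ℝ), Integrable fun z => v z * eta (s⁻¹ • (z - a)) := by
    intro a s
    refine Continuous.integrable_of_hasCompactSupport ?_ hc.mul_right
    have := hv.continuous
    have := eta_continuous (m := m)
    fun_prop
  set c := ∫ y : E m, eta y with hcdef
  have hcpos : 0 < c := eta_int_pos
  have key : ∀ z : E m, |v z * eta (r⁻¹ • (z - x)) - v z * eta (r⁻¹ • (z - x0))|
      ≤ (4 * ‖x - x0‖ / r) * (v z * eta ((3 * r)⁻¹ • (z - x0))) := by
    intro z
    rw [← mul_sub, abs_mul, abs_of_nonneg (hv0 z)]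
    rw [mul_left_comm]
    refine mul_le_mul_of_nonneg_left ?_ (hv0 z)
    rcases le_or_gt (2 * r) ‖z - x0‖ with h | h
    · rw [eta_eq_zero, eta_eq_zero, sub_self, abs_zero]
      · exact mul_nonneg (by positivity) (eta_nonneg _)
      · rw [norm_smul, norm_inv, Real.norm_of_nonneg hr.le, ← div_eq_inv_mul, le_div_iff₀ hr]
        linarith
      · rw [norm_smul, norm_inv, Real.norm_of_nonneg hr.le, ← div_eq_inv_mul, le_div_iff₀ hr]
        have : z - x0 = (z - x) + (x - x0) := by abel
        have h2 := norm_add_le (z - x) (x - x0)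
        rw [← this] at h2
        linarith
    · have h1 : 1 / 2 ≤ eta ((3 * r)⁻¹ • (z - x0)) := by
        unfold eta
        refine le_max_of_le_right ?_
        rw [norm_smul, norm_inv, Real.norm_of_nonneg (by positivity : (0:ℝ) ≤ 3 * r),
          ← div_eq_inv_mul]
        have h3 : ‖z - x0‖ / (3 * r) ≤ 2 / 3 := by
          rw [div_le_iff₀ (by positivity)]; linarith
        have h4 : 0 ≤ ‖z - x0‖ / (3 * r) := by positivity
        nlinarith
      refine (eta_lip _ _).trans ?_
      have h5 : r⁻¹ • (z - x) - r⁻¹ • (z - x0) = -(r⁻¹ • (x - x0)) := by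
        rw [← smul_sub, ← smul_neg]; congr 1; abel
      rw [h5, norm_neg, norm_smul, norm_inv, Real.norm_of_nonneg hr.le]
      have h6 : 0 ≤ 4 * ‖x - x0‖ / r := by positivity
      calc 2 * (r⁻¹ * ‖x - x0‖) = 4 * ‖x - x0‖ / r * (1 / 2) := by ring
        _ ≤ _ := mul_le_mul_of_nonneg_left h1 h6
  have hI : |r ^ m * (v x * c) - r ^ m * (v x0 * c)|
      ≤ (4 * ‖x - x0‖ / r) * ((3 * r) ^ m * (v x0 * c)) := by
    rw [← hmx, ← hm0, ← hm3, ← integral_sub (hint _ _) (hint _ _), ← integral_const_mul]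
    refine (abs_integral_le_integral_abs).trans ?_
    exact integral_mono ((hint _ _).sub (hint _ _)).abs ((hint _ _).const_mul _) key
  have hrm : 0 < r ^ m * c := by positivity
  have e1 : r ^ m * (v x * c) - r ^ m * (v x0 * c) = (v x - v x0) * (r ^ m * c) := by ring
  have e2 : (4 * ‖x - x0‖ / r) * ((3 * r) ^ m * (v x0 * c))
      = ((4 * 3 ^ m / r * v x0) * ‖x - x0‖) * (r ^ m * c) := by rw [mul_pow]; ring
  rw [e1, e2, abs_mul, abs_of_pos hrm] at hI
  exact le_of_mul_le_mul_right hI hrm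

lemma harm_grad {m : ℕ} {U : Set (E m)} (hU : IsOpen U) {u : E m → ℝ} (hu : HarmOn U u)
    {x0 : E m} {r : ℝ} (hr : 0 < r) (hb : closedBall x0 (4 * r) ⊆ U)
    (hpos : ∀ z ∈ closedBall x0 (4 * r), 0 ≤ u z) :
    ‖gradient u x0‖ ≤ 4 * 3 ^ m / r * u x0 := by
  have hx0 : x0 ∈ closedBall x0 (4 * r) := mem_closedBall_self (by positivity)
  have hd : DifferentiableAt ℝ u x0 :=
    (hu.1.contDiffAt (hU.mem_nhds (hb hx0))).differentiableAt (by norm_num)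
  have : ‖gradient u x0‖ = ‖fderiv ℝ u x0‖ := by
    unfold gradient; simp
  rw [this]
  refine hd.hasFDerivAt.le_of_lip' (mul_nonneg (by positivity) (hpos _ hx0)) ?_
  filter_upwards [closedBall_mem_nhds x0 hr] with x hx
  exact harm_lip hU hu hr hb hpos (by rwa [mem_closedBall, dist_eq_norm] at hx)

/-! ### The extended-real distance -/

lemma SF_top : SF ⊤ = Real.pi / 2 := by simp [SF]

lemma SF_coe (a : ℝ) : SF (a : EReal) = Real.arctan (Real.sinh a) := by
  simp [SF]

lemma SF_le (x : EReal) : SF x ≤ Real.pi / 2 := by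
  unfold SF
  split_ifs
  · exact le_rfl
  · linarith [Real.pi_pos]
  · exact (Real.arctan_lt_pi_div_two _).le

lemma SF_eq_top {x : EReal} (h : SF x = Real.pi / 2) : x = ⊤ := by
  by_contra hx
  unfold SF at h
  rw [if_neg hx] at h
  split_ifs at h
  · linarith [Real.pi_pos]
  · exact (Real.arctan_lt_pi_div_two _).ne h

lemma SF_neg (x : EReal) : SF (-x) = - SF x := by
  induction x with
  | bot => simp [SF]
  | top => simp [SF]
  | coe a => rw [← EReal.coe_neg, SF_coe, SF_coe, Real.sinh_neg, Real.arctan_neg]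

lemma le_of_SF_le {a b : ℝ} (h : SF (a : EReal) ≤ SF (b : EReal)) : a ≤ b := by
  rw [SF_coe, SF_coe] at h
  exact Real.sinh_le_sinh.1 (Real.arctan_strictMono.le_iff_le.1 h)

lemma HarmOn.neg {m : ℕ} {U : Set (E m)} {f : E m → ℝ} (h : HarmOn U f) :
    HarmOn U (fun x => - f x) := by
  refine ⟨h.1.neg, fun x hx => ?_⟩
  have h1 := h.2 x hx
  unfold lap at *
  simp only [fderiv_fun_neg, neg_apply, Finset.sum_neg_distrib]
  rw [h1, neg_zero]

lemma tilde_neg {m : ℕ} (f : E m → ℝ) (x : E m) : tilde (fun x => - f x) x = tilde f x := by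
  unfold tilde gradient
  simp [fderiv_fun_neg]

lemma TendstoCptsE.neg {m : ℕ} {U : Set (E m)} {g : ℕ → E m → ℝ} {G : E m → EReal}
    (h : TendstoCptsE U (fun n x => ((g n x : ℝ) : EReal)) G) :
    TendstoCptsE U (fun n x => ((- g n x : ℝ) : EReal)) (fun x => - G x) := by
  intro K hK hc ε hε
  obtain ⟨N, hN⟩ := h K hK hc ε hε
  refine ⟨N, fun n hn x hx => ?_⟩
  have := hN n hn x hx
  simp only [EReal.coe_neg, SF_neg]
  rw [← abs_neg]
  convert this using 2
  ring

lemma SFG_cont {m : ℕ} {U : Set (E m)} (hUo : IsOpen U)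
    {g : ℕ → E m → ℝ} (hg : ∀ n, HarmOn U (g n)) {G : E m → EReal}
    (hconv : TendstoCptsE U (fun n x => ((g n x : ℝ) : EReal)) G) :
    ContinuousOn (fun x => SF (G x)) U := by
  have h : TendstoLocallyUniformlyOn (fun n x => SF ((g n x : ℝ) : EReal)) (fun x => SF (G x))
      atTop U := by
    rw [tendstoLocallyUniformlyOn_iff_forall_isCompact hUo]
    intro K hK hc
    rw [Metric.tendstoUniformlyOn_iff]
    intro ε hε
    obtain ⟨N, hN⟩ := hconv K hK hc ε hε
    filter_upwards [eventually_ge_atTop N] with n hn x hx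
    rw [dist_comm]
    exact hN n hn x hx
  refine h.continuousOn (Frequently.of_forall fun n => ?_)
  simp only [SF_coe]
  exact Real.continuous_arctan.comp_continuousOn
    (Real.continuous_sinh.comp_continuousOn (hg n).1.continuousOn)

/-- If the limit is at least `SF M + ε` on a compact, eventually `g n ≥ M` there. -/
lemma eventually_ge {m : ℕ} {U : Set (E m)} {g : ℕ → E m → ℝ} {G : E m → EReal}
    (hconv : TendstoCptsE U (fun n x => ((g n x : ℝ) : EReal)) G) {K : Set (E m)} (hK : K ⊆ U)
    (hc : IsCompact K) {M s : ℝ} (hs : SF (M : EReal) < s) (hG : ∀ x ∈ K, s ≤ SF (G x)) :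
    ∀ᶠ n in atTop, ∀ x ∈ K, M ≤ g n x := by
  obtain ⟨N, hN⟩ := hconv K hK hc (s - SF (M : EReal)) (by linarith)
  filter_upwards [eventually_ge_atTop N] with n hn x hx
  have h1 := abs_lt.1 (hN n hn x hx)
  have h2 := hG x hx
  exact le_of_SF_le (by linarith [h1.1])

lemma SF_coe_lt (M : ℝ) : SF (M : EReal) < Real.pi / 2 := by
  rw [SF_coe]; exact Real.arctan_lt_pi_div_two _

lemma top_open {m : ℕ} {U : Set (E m)} (hUo : IsOpen U)
    {g : ℕ → E m → ℝ} (hg : ∀ n, HarmOn U (g n)) {G : E m → EReal}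
    (hconv : TendstoCptsE U (fun n x => ((g n x : ℝ) : EReal)) G) {x0 : E m} (hx0 : x0 ∈ U)
    (hG : G x0 = ⊤) : ∀ᶠ x in 𝓝 x0, G x = ⊤ := by
  have hcont := (SFG_cont hUo hg hconv).continuousAt (hUo.mem_nhds hx0)
  have h1 : ∀ᶠ x in 𝓝 x0, 1 < SF (G x) := by
    refine hcont.eventually (Ioi_mem_nhds ?_)
    simp only [hG, SF_top]; linarith [Real.pi_gt_three]
  obtain ⟨R, hR, hRb⟩ := Metric.nhds_basis_closedBall.mem_iff.1
    (Filter.inter_mem h1 (hUo.mem_nhds hx0))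
  set r := R / 4 with hr
  have hrpos : 0 < r := by positivity
  have hR4 : 4 * r = R := by rw [hr]; ring
  have hbU : closedBall x0 (4 * r) ⊆ U := by rw [hR4]; exact fun z hz => (hRb hz).2
  have hnn := eventually_ge hconv hbU (isCompact_closedBall _ _) (M := 0) (s := 1)
    (by rw [SF_coe]; simp) (by rw [hR4]; exact fun z hz => (hRb hz).1.le)
  set C : ℝ := 4 * 3 ^ m / r with hC
  have hCpos : 0 < C := by positivity
  have hδ : 0 < min r (1 / (2 * C)) := by positivity
  filter_upwards [closedBall_mem_nhds x0 hδ] with x hx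
  rw [mem_closedBall, dist_eq_norm] at hx
  have hxr : ‖x - x0‖ ≤ r := hx.trans (min_le_left _ _)
  have hxC : C * ‖x - x0‖ ≤ 1 / 2 := by
    have := hx.trans (min_le_right _ _)
    rw [le_div_iff₀ (by positivity)] at this
    linarith
  have hxU : x ∈ U := hbU (by rw [mem_closedBall, dist_eq_norm]; linarith)
  -- lower bound
  have hlow : ∀ M : ℝ, SF (M : EReal) ≤ SF (G x) := by
    intro M
    have hb := eventually_ge hconv (K := {x0}) (by simpa using hx0) isCompact_singleton
      (M := 2 * M) (s := Real.pi / 2) (SF_coe_lt _) (by simp [hG, SF_top])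
    refine le_of_forall_pos_lt_add fun ε hε => ?_
    obtain ⟨N, hN⟩ := hconv {x} (by simpa using hxU) isCompact_singleton ε hε
    obtain ⟨n, hn1, hn2, hn3⟩ := (hnn.and (hb.and (eventually_ge_atTop N))).exists
    have h3 := hN n hn3 x rfl
    have h4 := hn2 x0 rfl
    have h5 := harm_lip hUo (hg n) hrpos hbU hn1 hxr
    have h6 := hn1 x0 (mem_closedBall_self (by positivity))
    have h7 : M ≤ g n x := by
      have := (abs_le.1 h5).1
      nlinarith
    have h8 : SF (M : EReal) ≤ SF (g n x : EReal) := by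
      rw [SF_coe, SF_coe]
      exact Real.arctan_strictMono.monotone (Real.sinh_le_sinh.2 h7)
    linarith [(abs_lt.1 h3).2]
  apply SF_eq_top
  refine le_antisymm (SF_le _) ?_
  refine le_of_tendsto (f := fun M : ℝ => SF (M : EReal)) (x := atTop) ?_
    (Eventually.of_forall hlow)
  simp only [SF_coe]
  exact (Real.tendsto_arctan_atTop.mono_right nhdsWithin_le_nhds).comp
    Real.sinhOrderIso.tendsto_atTop

lemma top_all {m : ℕ} {U : Set (E m)} (hUo : IsOpen U) (hUc : IsConnected U)
    {g : ℕ → E m → ℝ} (hg : ∀ n, HarmOn U (g n)) {G : E m → EReal}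
    (hconv : TendstoCptsE U (fun n x => ((g n x : ℝ) : EReal)) G)
    (h : ∃ x ∈ U, G x = ⊤) : ∀ x ∈ U, G x = ⊤ := by
  have hA : IsOpen {x | x ∈ U ∧ G x = ⊤} := by
    rw [isOpen_iff_mem_nhds]
    rintro x ⟨hx, hGx⟩
    exact Filter.inter_mem (hUo.mem_nhds hx) (top_open hUo hg hconv hx hGx)
  have hB := (SFG_cont hUo hg hconv).isOpen_inter_preimage hUo (isOpen_Iio (a := Real.pi / 2))
  have := hUc.isPreconnected.subset_left_of_subset_union hA hB ?_ ?_ ?_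
  · exact fun x hx => (this hx).2
  · rw [Set.disjoint_left]
    rintro x ⟨_, h1⟩ ⟨_, h2⟩
    simp [h1, SF_top] at h2
  · intro x hx
    by_cases h1 : G x = ⊤
    · exact Or.inl ⟨hx, h1⟩
    · exact Or.inr ⟨hx, lt_of_le_of_ne (SF_le _) fun h2 => h1 (SF_eq_top h2)⟩
  · obtain ⟨x, hx, h1⟩ := h
    exact ⟨x, hx, hx, h1⟩

lemma sq_le_two_cosh {a : ℝ} (ha : 0 ≤ a) : a ^ 2 ≤ 4 * Real.cosh a := by
  have h1 := Real.quadratic_le_exp_of_nonneg ha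
  have h2 := Real.exp_pos (-a)
  rw [Real.cosh_eq]
  nlinarith

lemma tilde_top {m : ℕ} {U : Set (E m)} (hUo : IsOpen U)
    {g : ℕ → E m → ℝ} (hg : ∀ n, HarmOn U (g n)) {G : E m → EReal}
    (hconv : TendstoCptsE U (fun n x => ((g n x : ℝ) : EReal)) G)
    (h : ∀ x ∈ U, G x = ⊤) (K : Set (E m)) (hK : K ⊆ U) (hc : IsCompact K) :
    TendstoUniformlyOn (fun n x => tilde (g n) x) (fun _ => (0 : ℝ)) atTop K := by
  obtain ⟨δ, hδ, hsub⟩ := hc.exists_cthickening_subset_open hUo hK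
  rw [Metric.tendstoUniformlyOn_iff]
  intro ε hε
  set r := δ / 4 with hr
  have hrpos : 0 < r := by positivity
  have hR4 : 4 * r = δ := by rw [hr]; ring
  set C : ℝ := 4 * 3 ^ m / r with hC
  have hCpos : 0 < C := by positivity
  have hM : 0 < 8 * C / ε := by positivity
  have hev := eventually_ge hconv hsub hc.cthickening (M := 8 * C / ε) (s := Real.pi / 2)
    (SF_coe_lt _) (fun x hx => by rw [h x (hsub hx), SF_top])
  filter_upwards [hev] with n hn x hx
  have hb : closedBall x (4 * r) ⊆ cthickening δ K := by
    rw [hR4]; exact closedBall_subset_cthickening hx δ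
  have hgr := harm_grad hUo (hg n) hrpos (hb.trans hsub) (fun z hz => hM.le.trans (hn z (hb hz)))
  have hbig := hn x (hb (mem_closedBall_self (by positivity)))
  have hpos : 0 < g n x := hM.trans_le hbig
  have hcosh := sq_le_two_cosh hpos.le
  have hcp := Real.cosh_pos (g n x)
  have ht : 0 ≤ tilde (g n) x := by unfold tilde; positivity
  rw [dist_comm, dist_zero_right, Real.norm_of_nonneg ht]
  unfold tilde
  rw [div_lt_iff₀ hcp]
  rw [div_le_iff₀ hε] at hbig
  refine hgr.trans_lt ?_
  rw [← hC]
  nlinarith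

/-- **Harnack-type lemma.** If a sequence of harmonic functions on a domain `U` converges
uniformly on compacts (for the metric of `[-∞,+∞]`) to `G`, and `G` takes the value `+∞`
(resp. `-∞`) somewhere, then `G ≡ +∞` (resp. `G ≡ -∞`); moreover in that case `g̃_n → 0`
uniformly on every compact subset of `U`. -/
theorem stmt5 {m : ℕ} (U : Set (E m)) (hUo : IsOpen U) (hUc : IsConnected U)
    (g : ℕ → E m → ℝ) (hg : ∀ n, HarmOn U (g n))
    (G : E m → EReal)
    (hconv : TendstoCptsE U (fun n x => ((g n x : ℝ) : EReal)) G) :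
    ((∃ x ∈ U, G x = ⊤) → ∀ x ∈ U, G x = ⊤) ∧
    ((∃ x ∈ U, G x = ⊥) → ∀ x ∈ U, G x = ⊥) ∧
    (((∃ x ∈ U, G x = ⊤) ∨ (∃ x ∈ U, G x = ⊥)) →
      ∀ K ⊆ U, IsCompact K →
        TendstoUniformlyOn (fun n x => tilde (g n) x) (fun _ => (0 : ℝ)) atTop K) := by
  have hneg : ∀ n, HarmOn U (fun x => - g n x) := fun n => (hg n).neg
  have hconvn := hconv.neg
  have hbot : (∃ x ∈ U, G x = ⊥) → ∀ x ∈ U, (fun x => - G x) x = ⊤ := by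
    rintro ⟨x, hx, h⟩
    exact top_all hUo hUc hneg hconvn ⟨x, hx, by simp [h]⟩
  refine ⟨top_all hUo hUc hg hconv, fun h x hx => ?_, ?_⟩
  · simpa using hbot h x hx
  · rintro (h | h) K hK hc
    · exact tilde_top hUo hg hconv (top_all hUo hUc hg hconv h) K hK hc
    · have := tilde_top hUo hneg hconvn (hbot h) K hK hc
      simpa only [tilde_neg] using this
end
end

section
/- Let U be a domain in ℝ^m and f a harmonic function on U which is not identically zero. If f vanishes at some point of U, then there exists a point q ∈ U with f(q) = 0 and ∇f(q) ≠ 0. -/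
open Filter Topology Metric

noncomputable section

lemma second_nonneg (h h' : ℝ → ℝ) (c : ℝ) (h1 : ∀ᶠ t in 𝓝 (0:ℝ), HasDerivAt h (h' t) t)
    (h2 : HasDerivAt h' c 0) (hm : IsLocalMin h 0) : 0 ≤ c := by
  by_contra hc
  push Not at hc
  have e1 : deriv h =ᶠ[𝓝 0] h' := h1.mono fun t ht => ht.deriv
  have hd2 : deriv (deriv h) 0 = c := by rw [e1.deriv_eq, h2.deriv]
  have hmax : IsLocalMax h 0 := by
    apply isLocalMax_of_deriv_deriv_neg (by rw [hd2]; exact hc) hm.deriv_eq_zero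
    exact h1.self_of_nhds.continuousAt
  have hcst : h =ᶠ[𝓝 0] fun _ => h 0 := by
    filter_upwards [hm, hmax] with t a b using le_antisymm b a
  have : deriv h =ᶠ[𝓝 0] fun _ => 0 := by
    have := hcst.deriv
    simpa using this
  rw [this.deriv_eq] at hd2
  simp at hd2
  linarith

lemma hopf {m : ℕ} (U : Set (E m)) (hUo : IsOpen U) (f : E m → ℝ) (hf : HarmOn U f)
    (p q : E m) (r : ℝ) (hr : 0 < r) (hq : dist q p = r) (hB : closedBall p r ⊆ U)
    (hpos : ∀ x ∈ ball p r, 0 < f x) (hfq : f q ≤ 0) : f q = 0 ∧ fderiv ℝ f q ≠ 0 := by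
  have hqU : q ∈ U := hB (by simp [hq])
  have hcd : ∀ x ∈ U, ContDiffAt ℝ 2 f x := fun x hx => hf.1.contDiffAt (hUo.mem_nhds hx)
  have hcont : ContinuousOn f (closedBall p r) := hf.1.continuousOn.mono hB
  have hnn : ∀ x ∈ closedBall p r, 0 ≤ f x := by
    intro x hx
    rw [← closure_ball p hr.ne'] at hx hcont
    exact le_on_closure (f := fun _ => (0:ℝ)) (fun y hy => (hpos y hy).le) continuousOn_const hcont hx
  have hfq0 : f q = 0 := le_antisymm hfq (hnn q (by simp [hq]))
  refine ⟨hfq0, fun hgrad => ?_⟩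
  obtain ⟨y, hy, hymin⟩ := (isCompact_closedBall p (r/2)).exists_isMinOn
    (nonempty_closedBall.2 (by positivity))
    (hcont.mono (closedBall_subset_closedBall (by linarith)))
  have hc : 0 < f y := hpos y (closedBall_subset_ball (by linarith) hy)
  set c := f y with hcdef
  have hα : ∃ α : ℝ, 0 < α ∧ 2 * m < α * r ^ 2 := by
    refine ⟨(2 * m + 1) / r ^ 2, by positivity, ?_⟩
    rw [div_mul_cancel₀ _ (by positivity)]; linarith
  obtain ⟨α, hα0, hα⟩ := hα
  set w : E m → ℝ := fun x => f x - c * (Real.exp (-α * ‖x - p‖ ^ 2) - Real.exp (-α * r ^ 2)) with hw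
  let A : Set (E m) := closedBall p r ∩ {x | r / 2 ≤ dist x p}
  have hAc : IsCompact A := (isCompact_closedBall p r).inter_right
    (isClosed_le continuous_const (by fun_prop))
  have hwc : ContinuousOn w A := by
    apply ContinuousOn.sub (hcont.mono Set.inter_subset_left)
    fun_prop
  have key : ∀ x ∈ A, 0 ≤ w x := by
    obtain ⟨x0, hx0, hmin⟩ := hAc.exists_isMinOn ⟨q, by simp [A, hq, hr.le]⟩ hwc
    by_contra! hneg
    obtain ⟨x1, hx1, hx1n⟩ := hneg
    have hw0 : w x0 < 0 := lt_of_le_of_lt (hmin hx1) hx1n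
    have hd1 : dist x0 p < r := by
      refine lt_of_le_of_ne hx0.1 fun he => ?_
      have : w x0 = f x0 := by simp only [hw]; rw [← dist_eq_norm, he]; ring
      have := hnn x0 hx0.1
      linarith
    have hd2 : r / 2 < dist x0 p := by
      refine lt_of_le_of_ne hx0.2 fun he => ?_
      have h1 : c ≤ f x0 := hymin (by simp [← he])
      have h2 : Real.exp (-α * ‖x0 - p‖ ^ 2) ≤ 1 :=
        Real.exp_le_one_iff.2 (by nlinarith [sq_nonneg ‖x0 - p‖])
      have h3 := Real.exp_pos (-α * r ^ 2)
      have : 0 ≤ w x0 := by simp only [hw]; nlinarith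
      linarith
    have hloc : IsLocalMin w x0 := by
      have : A ∈ 𝓝 x0 := by
        apply Filter.inter_mem
        · exact closedBall_mem_nhds_of_mem hd1
        · exact mem_of_superset ((isOpen_lt continuous_const
            (by fun_prop : Continuous fun x : E m => dist x p)).mem_nhds hd2) fun z hz => by
              exact le_of_lt (show r / 2 < dist z p from hz)
      exact hmin.isLocalMin this
    have hx0U : x0 ∈ U := hB hx0.1
    have hsum : ∀ i : Fin m, 0 ≤ fderiv ℝ (fun y => fderiv ℝ f y (EuclideanSpace.single i 1)) x0
        (EuclideanSpace.single i 1)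
          - c * ((4 * α ^ 2 * ((x0 - p) i) ^ 2 - 2 * α) * Real.exp (-α * ‖x0 - p‖ ^ 2)) := by
      intro i
      set e : E m := EuclideanSpace.single i 1 with he
      have hline : ∀ t : ℝ, HasDerivAt (fun t : ℝ => x0 + t • e) e t := fun t => by
        simpa using ((hasDerivAt_id t).smul_const e).const_add x0
      have hnorm : ∀ t : ℝ, ‖x0 + t • e - p‖ ^ 2 = ‖x0 - p‖ ^ 2 + 2 * t * (x0 - p) i + t ^ 2 := by
        intro t
        rw [show x0 + t • e - p = (x0 - p) + t • e by abel, norm_add_sq_real, inner_smul_right,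
          norm_smul, he, EuclideanSpace.inner_single_right]
        simp [mul_pow]
        ring
      set N := ‖x0 - p‖ ^ 2
      set b := (x0 - p) i
      have hq1 : ∀ t : ℝ, HasDerivAt (fun t : ℝ => -α * (N + 2 * t * b + t ^ 2))
          (-α * (2 * b + 2 * t)) t := fun t => by
        have := ((((hasDerivAt_id t).const_mul 2).mul_const b).const_add N).add
          (hasDerivAt_pow 2 t)
        refine HasDerivAt.congr_deriv (this.const_mul (-α)) ?_
        simp
      refine second_nonneg (fun t => w (x0 + t • e))
        (fun t => fderiv ℝ f (x0 + t • e) e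
          - c * (Real.exp (-α * (N + 2 * t * b + t ^ 2)) * (-α * (2 * b + 2 * t)))) _ ?_ ?_ ?_
      · have hev : ∀ᶠ t : ℝ in 𝓝 0, x0 + t • e ∈ U := by
          have : ContinuousAt (fun t : ℝ => x0 + t • e) 0 := (hline 0).continuousAt
          exact this (hUo.mem_nhds (by simpa using hx0U))
        filter_upwards [hev] with t ht
        have hfd := ((hcd _ ht).differentiableAt (by norm_num)).hasFDerivAt.comp_hasDerivAt t (hline t)
        simp only [hw, hnorm]
        exact hfd.sub ((((hq1 t).exp).sub_const _).const_mul c)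
      · have hfd2 : DifferentiableAt ℝ (fun y => fderiv ℝ f y e) (x0 + (0:ℝ) • e) := by
          simp only [zero_smul, add_zero]
          have := ((hcd _ hx0U).fderiv_right (m := 1) (by norm_num)).differentiableAt (by norm_num)
          exact this.clm_apply (differentiableAt_const _)
        have h1 := hfd2.hasFDerivAt.comp_hasDerivAt (0:ℝ) (hline 0)
        have hl : HasDerivAt (fun t : ℝ => -α * (2 * b + 2 * t)) (-α * 2) 0 := by
          simpa using (((hasDerivAt_id (0:ℝ)).const_mul 2).const_add (2 * b)).const_mul (-α)
        have h2 := (((hq1 0).exp).mul hl).const_mul c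
        refine HasDerivAt.congr_deriv (h1.sub h2) ?_
        simp
        left
        ring
      · have : Tendsto (fun t : ℝ => x0 + t • e) (𝓝 0) (𝓝 x0) := by
          simpa [ContinuousAt] using (hline 0).continuousAt
        have h3 := this.eventually hloc
        simpa [IsLocalMin, IsMinFilter] using h3
    have hS := Finset.sum_nonneg fun i (_ : i ∈ Finset.univ) => hsum i
    rw [Finset.sum_sub_distrib] at hS
    have hl := hf.2 x0 hx0U
    unfold lap at hl
    rw [hl, ← Finset.mul_sum, ← Finset.sum_mul, Finset.sum_sub_distrib, ← Finset.mul_sum] at hS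
    have hN : ∑ i, ((x0 - p) i) ^ 2 = ‖x0 - p‖ ^ 2 := (EuclideanSpace.real_norm_sq_eq _).symm
    rw [hN] at hS
    simp only [Finset.sum_const, Finset.card_univ, Fintype.card_fin, nsmul_eq_mul] at hS
    rw [dist_eq_norm] at hd2
    have h5 : (r/2)^2 < ‖x0 - p‖ ^ 2 := by gcongr
    have h6 : 0 < 4 * α ^ 2 * ‖x0 - p‖ ^ 2 - m * (2 * α) := by
      have : 0 < α * (4 * α * ‖x0 - p‖ ^ 2 - 2 * m) := by
        apply mul_pos hα0
        nlinarith
      nlinarith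
    have := mul_pos hc (mul_pos h6 (Real.exp_pos (-α * ‖x0 - p‖ ^ 2)))
    linarith
  -- boundary derivative
  have hline : HasDerivAt (fun t : ℝ => q + t • (p - q)) (p - q) 0 := by
    simpa using ((hasDerivAt_id (0:ℝ)).smul_const (p - q)).const_add q
  have hdist : ∀ t : ℝ, ‖q + t • (p - q) - p‖ = |1 - t| * r := by
    intro t
    rw [show q + t • (p - q) - p = (1 - t) • (q - p) by module, norm_smul, ← dist_eq_norm q p, hq]
    simp
  have hwd : HasDerivAt (fun t : ℝ => w (q + t • (p - q)))
      (-(c * (Real.exp (-α * r ^ 2) * (2 * α * r ^ 2)))) 0 := by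
    have hfd : HasFDerivAt f (fderiv ℝ f q) (q + (0:ℝ) • (p - q)) := by
      simpa using ((hcd _ hqU).differentiableAt (by norm_num)).hasFDerivAt
    have h1 := hfd.comp_hasDerivAt (0:ℝ) hline
    rw [hgrad] at h1
    have h2 : HasDerivAt (fun t : ℝ => -α * ((1 - t) ^ 2 * r ^ 2)) (2 * α * r ^ 2) 0 := by
      have := ((((hasDerivAt_id (0:ℝ)).const_sub 1).pow 2).mul_const (r ^ 2)).const_mul (-α)
      refine HasDerivAt.congr_deriv (this) ?_
      simp
      ring
    simp only [hw, hdist, mul_pow, sq_abs]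
    refine HasDerivAt.congr_deriv (h1.sub ((h2.exp.sub_const (Real.exp (-α * r ^ 2))).const_mul c)) ?_
    simp
  have hw00 : w q = 0 := by simp only [hw]; rw [← dist_eq_norm, hq, hfq0]; ring
  have hlim := hwd.tendsto_slope_zero_right
  have : 0 ≤ -(c * (Real.exp (-α * r ^ 2) * (2 * α * r ^ 2))) := by
    refine ge_of_tendsto hlim ?_
    have : Set.Ioo (0:ℝ) (1/2) ∈ 𝓝[>] (0:ℝ) := Ioo_mem_nhdsGT (by norm_num)
    filter_upwards [this] with t ht
    simp only [zero_add, zero_smul, add_zero, hw00, sub_zero, smul_eq_mul]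
    refine mul_nonneg (inv_nonneg.2 ht.1.le) (key _ ?_)
    have h7 := hdist t
    rw [abs_of_pos (by linarith [ht.2])] at h7
    constructor
    · rw [mem_closedBall, dist_eq_norm, h7]; nlinarith [ht.1]
    · change r / 2 ≤ dist _ _
      rw [dist_eq_norm, h7]; nlinarith [ht.2]
  have : 0 < c * (Real.exp (-α * r ^ 2) * (2 * α * r ^ 2)) := by positivity
  linarith

lemma main_pos {m : ℕ} (U : Set (E m)) (hUo : IsOpen U) (hUc : IsConnected U)
    (f : E m → ℝ) (hf : HarmOn U f) (hnz : ∃ x ∈ U, 0 < f x)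
    (hz : ∃ x ∈ U, f x = 0) :
    ∃ q ∈ U, f q = 0 ∧ fderiv ℝ f q ≠ 0 := by
  have hcont := hf.1.continuousOn
  let P : Set (E m) := U ∩ f ⁻¹' Set.Ioi 0
  have hP : IsOpen P := hcont.isOpen_inter_preimage hUo isOpen_Ioi
  obtain ⟨a, haU, ha⟩ := hnz
  obtain ⟨b, hbU, hb⟩ := hz
  have hbP : b ∉ P := fun h => by have : 0 < f b := h.2; linarith
  have hex : ∃ z ∈ U, z ∈ closure P ∧ z ∉ P := by
    by_contra! hno
    obtain ⟨x, hxU, hx1, hx2⟩ := hUc.isPreconnected P (closure P)ᶜ hP isClosed_closure.isOpen_compl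
      (fun x hx => by
        by_cases h : x ∈ closure P
        · exact Or.inl (hno x hx h)
        · exact Or.inr h) ⟨a, haU, haU, ha⟩ ⟨b, hbU, fun h => hbP (hno b hbU h)⟩
    exact hx2 (subset_closure hx1)
  obtain ⟨z, hzU, hzc, hzP⟩ := hex
  have hfz : f z ≤ 0 := by
    by_contra! h
    exact hzP ⟨hzU, h⟩
  obtain ⟨ρ, hρ, hρU⟩ := Metric.isOpen_iff.1 hUo z hzU
  obtain ⟨p, hpP, hpd⟩ := Metric.mem_closure_iff.1 hzc (ρ / 2) (by positivity)
  have hsub : closedBall p (dist z p) ⊆ U := by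
    intro x hx
    apply hρU
    have h1 : dist x p ≤ dist z p := hx
    have := dist_triangle x p z
    rw [dist_comm p z] at this
    rw [mem_ball]; linarith
  have hK : IsCompact (closedBall p (dist z p) ∩ f ⁻¹' Set.Iic 0) :=
    (isCompact_closedBall p _).of_isClosed_subset
      ((hcont.mono hsub).preimage_isClosed_of_isClosed isClosed_closedBall isClosed_Iic)
      Set.inter_subset_left
  obtain ⟨q, hqK, hqmin⟩ := hK.exists_isMinOn ⟨z, by simp, hfz⟩
    (by fun_prop : ContinuousOn (fun x => dist x p) _)
  have hqd : dist q p ≤ dist z p := hqK.1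
  have hfq : f q ≤ 0 := hqK.2
  have hfp : 0 < f p := hpP.2
  refine ⟨q, hsub hqK.1, hopf U hUo f hf p q (dist q p) ?_ rfl
    ((closedBall_subset_closedBall hqd).trans hsub) ?_ hfq⟩
  · rw [dist_pos]
    rintro rfl
    linarith
  · intro x hx
    by_contra! hfx
    have hx' : dist x p < dist q p := hx
    have h2 : dist q p ≤ dist x p := hqmin ⟨(by rw [mem_closedBall]; linarith), hfx⟩
    linarith

lemma harm_neg {m : ℕ} (U : Set (E m)) (f : E m → ℝ) (hf : HarmOn U f) :
    HarmOn U (fun x => - f x) := by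
  refine ⟨hf.1.neg, fun x hx => ?_⟩
  have h := hf.2 x hx
  unfold lap at h ⊢
  simp only [fderiv_fun_neg, _root_.neg_apply, Finset.sum_neg_distrib, h, neg_zero]

/-- If a harmonic function on a domain is not identically zero but vanishes somewhere, it has
a zero where the gradient does not vanish. -/
theorem stmt6 {m : ℕ} (U : Set (E m)) (hUo : IsOpen U) (hUc : IsConnected U)
    (f : E m → ℝ) (hf : HarmOn U f) (hnz : ∃ x ∈ U, f x ≠ 0)
    (hz : ∃ x ∈ U, f x = 0) :
    ∃ q ∈ U, f q = 0 ∧ gradient f q ≠ 0 := by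
  have main : ∃ q ∈ U, f q = 0 ∧ fderiv ℝ f q ≠ 0 := by
    obtain ⟨x, hxU, hx⟩ := hnz
    rcases lt_or_gt_of_ne hx with h | h
    · obtain ⟨q, hq, h0, h1⟩ := main_pos U hUo hUc (fun x => - f x) (harm_neg U f hf)
        ⟨x, hxU, by linarith⟩ (by simpa using hz)
      refine ⟨q, hq, by linarith, ?_⟩
      rw [fderiv_fun_neg] at h1
      exact neg_ne_zero.1 h1
    · exact main_pos U hUo hUc f hf ⟨x, hxU, h⟩ hz
  obtain ⟨q, hq, h0, h1⟩ := main
  refine ⟨q, hq, h0, ?_⟩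
  unfold gradient
  simpa using h1
end
end
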